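/- arXiv:1702.03630 — 3 statements merged into one kernel-verified Lean document; each statement's English description precedes it below -/
import Mathlib

section
/- Let G be a bipartite graph with finite vertex classes U and V, |U| = m and |V| = n, edge set E(G) ⊆ U × V, and suppose G has no isolated vertices (every element of U and of V lies in some edge). Let c_U = (1/m, …, 1/m) ∈ ℝ^U and c_V = (−1/n, …, −1/n) ∈ ℝ^V. Then Q_G ∩ ({c_U} × ℝ^V) = {c_U} × (−(1/m)) • P_H, and Q_G ∩ (ℝ^U × {c_V}) = ((1/n) • P_H̄) × {c_V}. -/
open Pointwise

/-- The point `i_u − i_v` in `ℝ^U × ℝ^V` associated to an edge `(u, v)`. -/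
def rootPt {U V : Type*} [DecidableEq U] [DecidableEq V] (e : U × V) :
    (U → ℝ) × (V → ℝ) :=
  (Pi.single e.1 1, -Pi.single e.2 1)

/-- For a subset `I` of `V`, the simplex `Δ_I = conv{i_v : v ∈ I}` in `ℝ^V`. -/
def simplexOf {V : Type*} [DecidableEq V] (I : Set V) : Set (V → ℝ) :=
  convexHull ℝ ((fun v => Pi.single v (1 : ℝ)) '' I)

/-- The point set underlying the Cayley embedding of a family of subsets of a vector space. -/
def cayleySet {U M : Type*} [DecidableEq U] (S : U → Set M) : Set ((U → ℝ) × M) :=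
  ⋃ u, {Pi.single u 1} ×ˢ S u

/-- **Cayley trick**: the slice of the Cayley polytope at a positive weight vector `c` is the
weighted Minkowski sum of the summands. -/
theorem convexHull_cayleySet_inter {U M : Type*} [Fintype U] [DecidableEq U] [AddCommGroup M]
    [Module ℝ M] (S : U → Set M) (c : U → ℝ) (hc : ∀ u, 0 < c u) (hc1 : ∑ u, c u = 1) :
    convexHull ℝ (cayleySet S) ∩ ({c} ×ˢ Set.univ) =
      {c} ×ˢ ∑ u, c u • convexHull ℝ (S u) := by
  ext ⟨a, y⟩
  simp only [Set.mem_inter_iff, Set.mem_prod, Set.mem_singleton_iff, Set.mem_univ, and_true]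
  rw [and_comm]
  refine and_congr_right ?_
  rintro rfl
  rw [Set.mem_fintype_sum]
  constructor
  · intro h
    rw [convexHull_eq] at h
    obtain ⟨ι, t, w, z, hw, hw1, hz, hx⟩ := h
    rw [Finset.centerMass_eq_of_sum_1 _ _ hw1, Prod.ext_iff, Prod.fst_sum, Prod.snd_sum] at hx
    obtain ⟨hfst, hsnd⟩ := hx
    have hz' : ∀ i : t, ∃ u, (z i).1 = Pi.single u 1 ∧ (z i).2 ∈ S u := fun i => by
      simpa [cayleySet, Set.mem_prod] using hz i i.2
    choose p hp hpS using hz'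
    have hmarg : ∀ u, ∑ i : t with p i = u, w i = a u := fun u => by
      have hau := congrFun hfst u
      rw [← Finset.sum_coe_sort] at hau
      simpa [hp, Finset.sum_apply, Pi.single_apply, Finset.sum_filter, eq_comm] using hau
    refine ⟨fun u => ∑ i : t with p i = u, w i • (z i).2, fun u => ?_, ?_⟩
    · refine ⟨∑ i : t with p i = u, ((a u)⁻¹ * w i) • (z i).2, ?_, ?_⟩
      · refine (convex_convexHull ℝ (S u)).sum_mem
          (fun i _ => mul_nonneg (inv_nonneg.2 (hc u).le) (hw i i.2)) ?_ fun i hi => ?_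
        · rw [← Finset.mul_sum, hmarg, inv_mul_cancel₀ (hc u).ne']
        · exact subset_convexHull ℝ _ ((Finset.mem_filter.1 hi).2 ▸ hpS i)
      · simp only [mul_smul, ← Finset.smul_sum]
        exact smul_inv_smul₀ (hc u).ne' _
    · rw [Finset.sum_fiberwise, Finset.sum_coe_sort t fun i => w i • (z i).2]
      exact hsnd
  · rintro ⟨g, hg, rfl⟩
    choose x hx hxg using hg
    have hmem : ∀ u, (Pi.single u (1 : ℝ), x u) ∈ convexHull ℝ (cayleySet S) := fun u => by
      refine convexHull_mono (Set.subset_iUnion _ u) ?_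
      rw [convexHull_prod, convexHull_singleton]
      exact ⟨rfl, hx u⟩
    have hsum : (a, ∑ u, g u) = ∑ u, a u • ((Pi.single u (1 : ℝ) : U → ℝ), x u) := by
      refine Prod.ext ?_ ?_
      · ext v
        simp [Prod.fst_sum, Finset.sum_apply, Pi.single_apply]
      · simp [Prod.snd_sum, ← hxg]
    rw [hsum]
    exact (convex_convexHull ℝ (cayleySet S)).sum_mem (fun u _ => (hc u).le) hc1
      fun u _ => hmem u

theorem rootPt_image_eq_cayleySet {U V : Type*} [DecidableEq U] [DecidableEq V]
    (E : Set (U × V)) :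
    rootPt '' E =
      cayleySet fun u => -((fun v => Pi.single v (1 : ℝ)) '' {v | (u, v) ∈ E}) := by
  ext ⟨a, b⟩
  simp [cayleySet, rootPt, eq_comm]
  grind

/-- Exchanging the two factors and negating identifies the root polytope with the Cayley
polytope of the transposed bipartite graph. -/
theorem mem_convexHull_rootPt_iff {U V : Type*} [DecidableEq U] [DecidableEq V]
    (E : Set (U × V)) (a : U → ℝ) (b : V → ℝ) :
    (a, b) ∈ convexHull ℝ (rootPt '' E) ↔
      (-b, a) ∈ convexHull ℝ
        (cayleySet fun v => (fun u => Pi.single u (1 : ℝ)) '' {u | (u, v) ∈ E}) := by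
  let L : ((U → ℝ) × (V → ℝ)) ≃ₗ[ℝ] (V → ℝ) × (U → ℝ) :=
    (LinearEquiv.prodComm ℝ _ _).trans ((LinearEquiv.neg ℝ).prodCongr (LinearEquiv.refl ℝ _))
  have himage : L '' (rootPt '' E) =
      cayleySet fun v => (fun u => Pi.single u (1 : ℝ)) '' {u | (u, v) ∈ E} := by
    ext ⟨x, y⟩
    simp [L, cayleySet, rootPt, eq_comm]
    grind
  rw [← himage, ← L.coe_coe, ← LinearMap.image_convexHull]
  exact (L.injective.mem_set_image (a := (a, b))).symm

/-- **Cayley trick for bipartite graphs.**  Let `G` be a bipartite graph with finite vertex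
classes `U`, `V` of sizes `m`, `n` and no isolated vertices.  The slice of the root polytope
`Q_G` at `U`-coordinates all equal to `1/m` is `{c_U} × (−1/m) • P_H`, where
`P_H = ∑_{u ∈ U} Δ_{e(u)}` is the GP polytope of `H`; and the slice at `V`-coordinates all
equal to `−1/n` is `(1/n) • P_H̄ × {c_V}`, where `P_H̄ = ∑_{v ∈ V} Δ_{e(v)}`. -/
theorem rootPolytope_slices_eq_GP_polytopes (U V : Type*) [Fintype U] [Fintype V]
    [DecidableEq U] [DecidableEq V] [Nonempty U] [Nonempty V]
    (E : Set (U × V))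
    (hU : ∀ u : U, ∃ v, (u, v) ∈ E) (hV : ∀ v : V, ∃ u, (u, v) ∈ E) :
    (convexHull ℝ (rootPt '' E) ∩
        (({fun _ => 1 / (Fintype.card U : ℝ)} : Set (U → ℝ)) ×ˢ (Set.univ : Set (V → ℝ)))
      = ({fun _ => 1 / (Fintype.card U : ℝ)} : Set (U → ℝ)) ×ˢ
          ((-(1 / (Fintype.card U : ℝ))) • ∑ u : U, simplexOf {v | (u, v) ∈ E})) ∧
    (convexHull ℝ (rootPt '' E) ∩
        ((Set.univ : Set (U → ℝ)) ×ˢ ({fun _ => -(1 / (Fintype.card V : ℝ))} : Set (V → ℝ)))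
      = ((1 / (Fintype.card V : ℝ)) • ∑ v : V, simplexOf {u | (u, v) ∈ E}) ×ˢ
          ({fun _ => -(1 / (Fintype.card V : ℝ))} : Set (V → ℝ))) := by
  have hm : (0 : ℝ) < 1 / Fintype.card U := by positivity
  have hn : (0 : ℝ) < 1 / Fintype.card V := by positivity
  constructor
  · rw [rootPt_image_eq_cayleySet, convexHull_cayleySet_inter _ _ (fun _ => hm) (by simp)]
    simp only [convexHull_neg, ← Finset.smul_sum, Finset.sum_neg_distrib, Set.smul_set_neg,
      Set.neg_smul_set, simplexOf]
  · have key := convexHull_cayleySet_inter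
      (fun v => (fun u => Pi.single u (1 : ℝ)) '' {u | (u, v) ∈ E})
      (fun _ => 1 / (Fintype.card V : ℝ)) (fun _ => hn) (by simp)
    rw [← Finset.smul_sum] at key
    ext ⟨a, b⟩
    have hb : b = (fun _ => -(1 / (Fintype.card V : ℝ))) ↔
        -b = fun _ => 1 / (Fintype.card V : ℝ) := neg_eq_iff_eq_neg.symm
    have hab := Set.ext_iff.1 key (-b, a)
    simp only [Set.mem_inter_iff, Set.mem_prod, Set.mem_singleton_iff, Set.mem_univ, and_true,
      true_and] at hab ⊢
    rw [mem_convexHull_rootPt_iff, hb, hab, and_comm]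
    rfl
end

section
/- Let D be a finite directed graph on a finite vertex set W, given by its edge set E(D) ⊆ W × W, and suppose D is balanced: for every w ∈ W, the in-degree |{x : (x,w) ∈ E(D)}| equals the out-degree |{x : (w,x) ∈ E(D)}|. Then for any two vertices r, r' ∈ W, the number of spanning arborescences of D rooted at r equals the number of spanning arborescences of D rooted at r'. -/
/-- `A` is a spanning arborescence rooted at `r` of the directed graph with edge set `E`:
`A ⊆ E`, no edge of `A` ends at `r`, every vertex `w ≠ r` has exactly one edge of `A`
ending at it, and every vertex is reachable from `r` by a directed path of edges of `A`. -/
def IsSpanningArborescence {W : Type*} (E A : Set (W × W)) (r : W) : Prop :=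
  A ⊆ E ∧ (∀ e ∈ A, e.2 ≠ r) ∧ (∀ w : W, w ≠ r → ∃! e : W × W, e ∈ A ∧ e.2 = w) ∧
  (∀ w : W, Relation.ReflTransGen (fun x y => (x, y) ∈ A) r w)

/-- Parent maps along edges of `E` all of whose forward orbits reach `r`: their functional graphs
have a single cycle, and `r` lies on it. -/
def cyclicParentMaps {W : Type*} (E : Set (W × W)) (r : W) : Set (W → W) :=
  {f | (∀ w, (f w, w) ∈ E) ∧ ∀ w, ∃ n : ℕ, f^[n] w = r}

/-- Deleting the edge `(x, r)` entering the root identifies the parent maps with `f r = x` with the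
spanning arborescences rooted at `r`. -/
theorem ncard_cyclicParentMaps_fiber {W : Type*} {E : Set (W × W)} {x r : W}
    (hx : (x, r) ∈ E) :
    {f ∈ cyclicParentMaps E r | f r = x}.ncard
      = {A : Set (W × W) | IsSpanningArborescence E A r}.ncard := by
  refine Set.ncard_congr (fun f _ => {e : W × W | e.2 ≠ r ∧ f e.2 = e.1}) ?_ ?_ ?_
  · rintro f ⟨⟨hE, hreach⟩, -⟩
    refine ⟨?_, fun e he => he.1, ?_, ?_⟩
    · rintro ⟨a, b⟩ ⟨-, hab : f b = a⟩
      exact hab ▸ hE b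
    · intro w hw
      refine ⟨(f w, w), ⟨⟨hw, rfl⟩, rfl⟩, ?_⟩
      rintro ⟨a, b⟩ ⟨⟨-, h⟩, rfl⟩
      exact Prod.ext h.symm rfl
    · intro w
      obtain ⟨n, hn⟩ := hreach w
      induction n generalizing w with
      | zero => exact hn ▸ Relation.ReflTransGen.refl
      | succ n ih =>
        by_cases hw : w = r
        · exact hw ▸ Relation.ReflTransGen.refl
        · exact (ih (f w) hn).tail ⟨hw, rfl⟩
  · rintro f g ⟨-, hf⟩ ⟨-, hg⟩ h
    funext w
    by_cases hw : w = r
    · rw [hw, hf, hg]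
    · have hmem : (f w, w) ∈ {e : W × W | e.2 ≠ r ∧ g e.2 = e.1} := h ▸ ⟨hw, rfl⟩
      exact hmem.2.symm
  · rintro A ⟨hAE, hroot, huniq, hreach⟩
    have hparent : ∀ w, ∃ a, (w = r → a = x) ∧ (w ≠ r → (a, w) ∈ A) := by
      intro w
      by_cases hw : w = r
      · exact ⟨x, fun _ => rfl, fun h => absurd hw h⟩
      · obtain ⟨⟨a, b⟩, ⟨he, rfl⟩, -⟩ := huniq w hw
        exact ⟨a, fun h => absurd h hw, fun _ => he⟩
    choose f hfr hfA using hparent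
    have hmem : ∀ a b, (a, b) ∈ A → f b = a := fun a b hab =>
      congrArg Prod.fst
        ((huniq b (hroot _ hab)).unique ⟨hfA b (hroot _ hab), rfl⟩ ⟨hab, rfl⟩)
    refine ⟨f, ⟨⟨fun w => ?_, fun w => ?_⟩, hfr r rfl⟩, ?_⟩
    · by_cases hw : w = r
      · rw [hfr w hw, hw]
        exact hx
      · exact hAE (hfA w hw)
    · induction hreach w with
      | refl => exact ⟨0, rfl⟩
      | @tail b c _ hbc ih =>
        obtain ⟨n, hn⟩ := ih
        exact ⟨n + 1, by rw [Function.iterate_succ_apply, hmem b c hbc, hn]⟩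
    · ext ⟨a, b⟩
      constructor
      · rintro ⟨hb, hab : f b = a⟩
        exact hab ▸ hfA b hb
      · exact fun hab => ⟨hroot _ hab, hmem a b hab⟩

/-- If `f y = f z` and each of `y`, `z` lies on the forward orbit of the other, then `y = z`. -/
theorem eq_of_apply_eq_of_iterate_eq {α : Type*} {f : α → α} {y z : α} (h : f y = f z)
    {m n : ℕ} (hn : f^[n] y = z) (hm : f^[m] z = y) : y = z := by
  cases n with
  | zero => exact hn
  | succ n =>
    have hz : f^[n + 1] z = z := by
      rw [Function.iterate_succ_apply, ← h, ← Function.iterate_succ_apply, hn]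
    calc y = f^[m] (f^[n + 1] z) := by rw [hz, hm]
      _ = f^[n + 1] (f^[m] z) := by
        rw [← Function.iterate_add_apply, add_comm, Function.iterate_add_apply]
      _ = z := by rw [hm, hn]

/-- The cyclic vertices of a parent map are closed under taking parents. -/
theorem mem_cyclicParentMaps_apply {W : Type*} {E : Set (W × W)} {y : W} {f : W → W}
    (hf : f ∈ cyclicParentMaps E y) : f ∈ cyclicParentMaps E (f y) := by
  refine ⟨hf.1, fun w => ?_⟩
  obtain ⟨m, hm⟩ := hf.2 w
  exact ⟨m + 1, by rw [Function.iterate_succ_apply', hm]⟩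

/-- Every cyclic vertex of a parent map is the parent of a cyclic vertex. -/
theorem exists_mem_cyclicParentMaps_apply_eq {W : Type*} {E : Set (W × W)} {r : W} {f : W → W}
    (hf : f ∈ cyclicParentMaps E r) : ∃ y, f ∈ cyclicParentMaps E y ∧ f y = r := by
  obtain ⟨n, hn⟩ := hf.2 (f r)
  refine ⟨f^[n] r, ⟨hf.1, fun w => ?_⟩, ?_⟩
  · obtain ⟨m, hm⟩ := hf.2 w
    exact ⟨n + m, by rw [Function.iterate_add_apply, hm]⟩
  · rw [← Function.iterate_succ_apply' f, Function.iterate_succ_apply, hn]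

/-- The number of spanning arborescences, as a function of the root, satisfies the balance equation
of the random walk: both sides count the elements of `cyclicParentMaps E r`. -/
theorem indegree_mul_ncard_arborescences {W : Type*} [Fintype W] (E : Set (W × W)) (r : W) :
    {x | (x, r) ∈ E}.ncard * {A : Set (W × W) | IsSpanningArborescence E A r}.ncard
      = ∑ y ∈ {y | (r, y) ∈ E}.toFinite.toFinset,
          {A : Set (W × W) | IsSpanningArborescence E A y}.ncard := by
  classical
  have hin : (cyclicParentMaps E r).toFinite.toFinset
      = {x | (x, r) ∈ E}.toFinite.toFinset.biUnion fun x =>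
          {f ∈ cyclicParentMaps E r | f r = x}.toFinite.toFinset := by
    ext f
    simpa using fun hf : f ∈ cyclicParentMaps E r => hf.1 r
  have hout : (cyclicParentMaps E r).toFinite.toFinset
      = {y | (r, y) ∈ E}.toFinite.toFinset.biUnion fun y =>
          {f ∈ cyclicParentMaps E y | f y = r}.toFinite.toFinset := by
    ext f
    simp only [Set.Finite.mem_toFinset, Finset.mem_biUnion, Set.mem_ofPred_eq]
    constructor
    · intro hf
      obtain ⟨y, hy⟩ := exists_mem_cyclicParentMaps_apply_eq hf
      exact ⟨y, by simpa [hy.2] using hy.1.1 y, hy⟩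
    · rintro ⟨y, -, hf, rfl⟩
      exact mem_cyclicParentMaps_apply hf
  have hcard := congrArg Finset.card (hin.symm.trans hout)
  rw [Finset.card_biUnion, Finset.card_biUnion] at hcard
  · simp only [← Set.ncard_eq_toFinset_card] at hcard
    rw [Finset.sum_congr rfl fun x hx =>
        ncard_cyclicParentMaps_fiber (x := x) (by simpa using hx),
      Finset.sum_congr rfl fun y hy =>
        ncard_cyclicParentMaps_fiber (r := y) (by simpa using hy),
      Finset.sum_const, smul_eq_mul, ← Set.ncard_eq_toFinset_card] at hcard
    exact hcard
  · intro y _ z _ hyz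
    refine Finset.disjoint_left.2 fun f hfy hfz => hyz ?_
    simp only [Set.Finite.mem_toFinset, Set.mem_ofPred_eq] at hfy hfz
    obtain ⟨n, hn⟩ := hfz.1.2 y
    obtain ⟨m, hm⟩ := hfy.1.2 z
    exact eq_of_apply_eq_of_iterate_eq (hfy.2.trans hfz.2.symm) hn hm
  · intro x _ z _ hxz
    refine Finset.disjoint_left.2 fun f hfx hfz => hxz ?_
    simp only [Set.Finite.mem_toFinset, Set.mem_ofPred_eq] at hfx hfz
    exact hfx.2.symm.trans hfz.2

/-- In a balanced finite directed graph (in-degree equals out-degree at every vertex),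
the number of spanning arborescences does not depend on the choice of root vertex. -/
theorem card_spanning_arborescences_root_indep (W : Type*) [Fintype W] [Nonempty W]
    (E : Set (W × W))
    (hbal : ∀ w : W, {x | (x, w) ∈ E}.ncard = {x | (w, x) ∈ E}.ncard)
    (r r' : W) :
    {A : Set (W × W) | IsSpanningArborescence E A r}.ncard
      = {A : Set (W × W) | IsSpanningArborescence E A r'}.ncard := by
  set t : W → ℕ := fun w => {A : Set (W × W) | IsSpanningArborescence E A w}.ncard
  obtain ⟨r₀, hmax⟩ := Finite.exists_max t
  have hstep : ∀ v, t v = t r₀ → ∀ w, (v, w) ∈ E → t w = t r₀ := by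
    intro v hv w hw
    have hsum : ∑ y ∈ {y | (v, y) ∈ E}.toFinite.toFinset, t y
        = ∑ _y ∈ {y | (v, y) ∈ E}.toFinite.toFinset, t r₀ := by
      rw [Finset.sum_const, smul_eq_mul, ← Set.ncard_eq_toFinset_card, ← hbal v, ← hv]
      exact (indegree_mul_ncard_arborescences E v).symm
    exact (Finset.sum_eq_sum_iff_of_le fun y _ => hmax y).1 hsum w (by simpa using hw)
  have hall : ∀ w, t w = t r₀ := by
    intro w
    rcases Nat.eq_zero_or_pos (t r₀) with h | h
    · have := hmax w
      omega
    · obtain ⟨A, hAE, -, -, hreach⟩ := Set.nonempty_of_ncard_ne_zero h.ne'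
      induction hreach w with
      | refl => rfl
      | tail _ hbc ih => exact hstep _ ih _ (hAE hbc)
  exact (hall r).trans (hall r').symm
end

section
/- Let V be a finite nonempty set and let X, Y ⊆ V be nonempty subsets with X ∩ Y nonempty. Then, in ℝ^V, Δ_{X∪Y} + Δ_{X∩Y} ⊆ Δ_X + Δ_Y, where + denotes the Minkowski sum. -/
open Pointwise

/-- For nonempty subsets `X, Y` of a finite set `V` with `X ∩ Y` nonempty, in `ℝ^V` we have
`Δ_{X∪Y} + Δ_{X∩Y} ⊆ Δ_X + Δ_Y` (Minkowski sums). -/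
theorem simplex_union_inter_subset_sum (V : Type*) [Fintype V] [DecidableEq V] [Nonempty V]
    (X Y : Set V) (hX : X.Nonempty) (hY : Y.Nonempty) (hXY : (X ∩ Y).Nonempty) :
    simplexOf (X ∪ Y) + simplexOf (X ∩ Y) ⊆ simplexOf X + simplexOf Y := by
  unfold simplexOf
  rw [← convexHull_add, ← convexHull_add]
  apply convexHull_mono
  rintro _ ⟨_, ⟨u, hu | hu, rfl⟩, _, ⟨w, ⟨hwX, hwY⟩, rfl⟩, rfl⟩
  · exact Set.add_mem_add (Set.mem_image_of_mem _ hu) (Set.mem_image_of_mem _ hwY)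
  · rw [add_comm (_ '' X)]
    exact Set.add_mem_add (Set.mem_image_of_mem _ hu) (Set.mem_image_of_mem _ hwX)
end
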